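/- Let F/K be a finite field extension and E an intermediate field, K ⊆ E ⊆ F. Write Υ_{F/K} for the kernel of the conormal map I/I² → Ω¹_{K[X₁,…,X_n]/K} ⊗ F associated to a presentation of F over K (the module of imperfection, equal to π₁ of the cotangent complex). Then dim_F Ω¹_{F/K} = dim_F Υ_{F/K} and dim_E Ω¹_{E/K} = dim_E Υ_{E/K}; i.e., Cartier's equality holds with transcendence degree zero for both algebraic extensions F/K and E/K. -/

import Mathlib

theorem height_maximal_mvPolynomial (K : Type*) [Field K] (ι : Type*) [Finite ι] (I : Ideal (MvPolynomial ι K))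
    [hI : I.IsMaximal] : I.height = Nat.card ι := by
  induction ι using Finite.induction_empty_option with
  | of_equiv e H =>
    rw [← (MvPolynomial.renameEquiv K e.symm).toRingEquiv.height_map I]
    have := Ideal.map_isMaximal_of_equiv (MvPolynomial.renameEquiv K e.symm).toRingEquiv (p := I)
    rw [H, Nat.card_congr e]
  | h_empty =>
    rw [← (MvPolynomial.isEmptyRingEquiv K PEmpty).height_map I]
    have := Ideal.map_isMaximal_of_equiv (MvPolynomial.isEmptyRingEquiv K PEmpty) (p := I)
    rw [Ideal.eq_bot_of_prime (Ideal.map (MvPolynomial.isEmptyRingEquiv K PEmpty) I)]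
    simp
  | @h_option ι _ IH =>
    rw [← (MvPolynomial.optionEquivLeft K ι).toRingEquiv.height_map I]
    have := Ideal.map_isMaximal_of_equiv (MvPolynomial.optionEquivLeft K ι).toRingEquiv (p := I)
    generalize Ideal.map (MvPolynomial.optionEquivLeft K ι).toRingEquiv I = J at *
    have h2 : (J.under (MvPolynomial ι K)).IsMaximal :=
      Polynomial.isMaximal_comap_C_of_isJacobsonRing J
    rw [Polynomial.height_eq_height_add_one (J.under _) J, IH]
    simp


open IsLocalRing in
theorem mapCotangent_localization_bijective {S : Type*} [CommRing S] (I : Ideal S) [I.IsMaximal]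
    (h : I ≤ (maximalIdeal (Localization.AtPrime I)).comap
      (Algebra.ofId S (Localization.AtPrime I))) :
    Function.Bijective (Ideal.mapCotangent I (maximalIdeal (Localization.AtPrime I))
      (Algebra.ofId S (Localization.AtPrime I)) h) := by
  let e := IsLocalization.AtPrime.equivQuotMaximalIdealPow I (Localization.AtPrime I) 2
  have he (x : S) : e (Ideal.Quotient.mk _ x) =
      Ideal.Quotient.mk _ (algebraMap S (Localization.AtPrime I) x) := e.commutes x
  constructor
  · rw [injective_iff_map_eq_zero]
    intro x hx
    obtain ⟨x, rfl⟩ := I.toCotangent_surjective x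
    rw [Ideal.mapCotangent_toCotangent, Ideal.toCotangent_eq_zero] at hx
    rw [Ideal.toCotangent_eq_zero, ← Ideal.Quotient.eq_zero_iff_mem]
    apply e.injective
    rw [he, map_zero, Ideal.Quotient.eq_zero_iff_mem]
    exact hx
  · intro y
    obtain ⟨y, rfl⟩ := (maximalIdeal (Localization.AtPrime I)).toCotangent_surjective y
    obtain ⟨x, hx⟩ := e.surjective (Ideal.Quotient.mk _ y.1)
    obtain ⟨x, rfl⟩ := Ideal.Quotient.mk_surjective x
    rw [he, Ideal.Quotient.eq] at hx
    have hm : algebraMap S (Localization.AtPrime I) x ∈ maximalIdeal (Localization.AtPrime I) := by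
      have := add_mem (Ideal.pow_le_self two_ne_zero hx) y.2
      simpa using this
    have hxI : x ∈ I := (IsLocalization.AtPrime.to_map_mem_maximal_iff _ I x).1 hm
    refine ⟨I.toCotangent ⟨x, hxI⟩, ?_⟩
    rw [Ideal.mapCotangent_toCotangent, Ideal.toCotangent_eq]
    exact hx

open IsLocalRing in
theorem finrank_extension_cotangent {K F ι : Type*} [Field K] [Field F] [Algebra K F] [Finite ι]
    (P : Algebra.Generators K F ι) :
    Module.finrank F P.toExtension.Cotangent = Nat.card ι := by
  let I : Ideal P.toExtension.Ring := P.toExtension.ker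
  have hs : Function.Surjective (algebraMap P.toExtension.Ring F) :=
    P.toExtension.algebraMap_surjective
  have hI : I.IsMaximal := RingHom.ker_isMaximal_of_surjective _ hs
  let A := Localization.AtPrime I
  have : IsRegularRing P.toExtension.Ring :=
    MvPolynomial.isRegularRing_of_isRegularRing (R := K) (ι := ι)
  have hreg : IsRegularLocalRing A := IsRegularRing.isRegularLocalRing_localization I
  have h1 := (IsRegularLocalRing.iff_finrank_cotangentSpace A).1 hreg
  have hh : I.height = Nat.card ι := height_maximal_mvPolynomial K ι (hI := hI) I
  rw [IsLocalization.AtPrime.ringKrullDim_eq_height I A, hh] at h1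
  have h2 : Module.finrank (ResidueField A) (CotangentSpace A) = Nat.card ι := by
    exact_mod_cast h1
  rw [← h2]
  have h : I ≤ (maximalIdeal A).comap (Algebra.ofId P.toExtension.Ring A) := fun x hx =>
    (IsLocalization.AtPrime.to_map_mem_maximal_iff A I x).2 hx
  let j : P.toExtension.Cotangent ≃+ CotangentSpace A :=
    P.toExtension.cotangentEquivCotangentKer.toAddEquiv.trans
      (AddEquiv.ofBijective (Ideal.mapCotangent I (maximalIdeal A) _ h)
        (mapCotangent_localization_bijective I h))
  let i : F ≃+* ResidueField A :=
    (RingHom.quotientKerEquivOfSurjective hs).symm.trans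
      (IsLocalization.AtPrime.equivQuotMaximalIdeal I A)
  have hi (x : P.toExtension.Ring) : i (algebraMap _ F x) = residue A (algebraMap _ A x) := by
    have : (RingHom.quotientKerEquivOfSurjective hs).symm (algebraMap _ F x)
        = Ideal.Quotient.mk _ x := by
      rw [RingEquiv.symm_apply_eq]; rfl
    change IsLocalization.AtPrime.equivQuotMaximalIdeal I A
      ((RingHom.quotientKerEquivOfSurjective hs).symm (algebraMap _ F x)) = _
    rw [this]
    exact IsLocalization.AtPrime.equivQuotMaximalIdeal_apply_mk I A x
  have key := lift_rank_eq_of_equiv_equiv i j i.bijective (by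
    intro r m
    obtain ⟨x, rfl⟩ := hs r
    rw [hi, algebraMap_smul]
    change Ideal.mapCotangent I (maximalIdeal A) _ h
      (P.toExtension.cotangentEquivCotangentKer (x • m)) = _
    rw [map_smul, map_smul, ← IsLocalRing.ResidueField.algebraMap_eq, algebraMap_smul,
      algebraMap_smul]
    rfl)
  simpa [Module.finrank] using congr_arg Cardinal.toNat key

theorem cartier_finite (K F : Type*) [Field K] [Field F] [Algebra K F] [FiniteDimensional K F] :
    Module.finrank F (Ω[F⁄K]) = Module.finrank F (Algebra.H1Cotangent K F) := by
  obtain ⟨n, ⟨P⟩⟩ := (Algebra.FiniteType.iff_exists_generators (R := K) (S := F)).mp inferInstance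
  rw [(Algebra.Generators.H1Cotangent.equiv (Algebra.Generators.self K F) P).finrank_eq]
  have hc := finrank_extension_cotangent P
  have hcs : Module.finrank F P.toExtension.CotangentSpace = Nat.card (Fin n) := by
    rw [Module.finrank_eq_nat_card_basis P.cotangentSpaceBasis]
  have : IsNoetherianRing P.toExtension.Ring :=
    inferInstanceAs (IsNoetherianRing (MvPolynomial (Fin n) K))
  have f1 : Module.Finite F P.toExtension.Cotangent :=
    Algebra.Extension.Cotangent.finite (IsNoetherian.noetherian _)
  have f2 : Module.Finite F P.toExtension.CotangentSpace := .of_basis P.cotangentSpaceBasis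
  have e1 := LinearMap.finrank_range_add_finrank_ker P.toExtension.cotangentComplex
  have e2 := LinearMap.finrank_range_add_finrank_ker P.toExtension.toKaehler
  rw [LinearMap.exact_iff.mp P.toExtension.exact_cotangentComplex_toKaehler,
    LinearMap.range_eq_top.2 P.toExtension.toKaehler_surjective, finrank_top] at e2
  change _ = Module.finrank F (LinearMap.ker P.toExtension.cotangentComplex)
  omega


set_option synthInstance.maxHeartbeats 1000000
set_option maxHeartbeats 1000000

/-- Cartier's equality with transcendence degree zero: for a finite field extension
`F/K` and an intermediate field `E`, `dim Ω¹ = dim Υ` (the module of imperfection,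
i.e. `H¹` of the cotangent complex) for both `F/K` and `E/K`. -/
theorem stmt17 (K F : Type*) [Field K] [Field F] [Algebra K F] [FiniteDimensional K F]
    (E : IntermediateField K F) :
    Module.finrank F (Ω[F⁄K]) = Module.finrank F (Algebra.H1Cotangent K F) ∧
      Module.finrank ↥E (Ω[↥E⁄K]) = Module.finrank ↥E (Algebra.H1Cotangent K ↥E) := by
  exact ⟨cartier_finite K F, cartier_finite K E⟩
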